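/- Let u ∈ k^* and let α ∈ Aff_3(k) \ B have type (γ1,γ2,γ3). If (γ1,γ2,γ3) = (1,2,3), then there exists a lift of α which satisfies condition (C). -/

import Mathlib

open MvPolynomial

noncomputable section

namespace YasudaPaper

variable {k : Type*} [Field k]

/-- `f := x1*x3 - x2^2` (variables: `X 0 = x1, X 1 = x2, X 2 = x3`). -/
def fP : MvPolynomial (Fin 3) k := X 0 * X 2 - X 1 ^ 2

/-- `r := x2*f + x1^2`. -/
def rP : MvPolynomial (Fin 3) k := X 1 * fP + X 0 ^ 2

/-- `g := x3*f^2 + 2*x1*x2*f + x1^3`. -/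
def gP : MvPolynomial (Fin 3) k := X 2 * fP ^ 2 + 2 * X 0 * X 1 * fP + X 0 ^ 3

/-- The Jacobian derivation `Δ = Δ_{(f,g)}`, `h ↦ det ∂(f,g,h)/∂(x1,x2,x3)`. -/
def Del (h : MvPolynomial (Fin 3) k) : MvPolynomial (Fin 3) k :=
  Matrix.det !![pderiv 0 fP, pderiv 1 fP, pderiv 2 fP;
                pderiv 0 gP, pderiv 1 gP, pderiv 2 gP;
                pderiv 0 h,  pderiv 1 h,  pderiv 2 h]

/-- `φ = exp D`: for every `h` and every `N` with `D^[N] h = 0`,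
    `φ h = ∑_{i<N} D^i(h)/i!`.  (For a locally nilpotent `D` this characterizes
    the exponential automorphism.) -/
def IsExpOf {σ : Type*} (D : MvPolynomial σ k → MvPolynomial σ k)
    (φ : MvPolynomial σ k ≃ₐ[k] MvPolynomial σ k) : Prop :=
  ∀ (h : MvPolynomial σ k) (N : ℕ), D^[N] h = 0 →
    φ h = ∑ i ∈ Finset.range N, (Nat.factorial i : k)⁻¹ • D^[i] h

/-- `α` is an affine automorphism: `α(x_i) = ∑_j a_{j,i} x_j + b_i` with `A ∈ GL₃(k)`. -/
def IsAffine (α : MvPolynomial (Fin 3) k ≃ₐ[k] MvPolynomial (Fin 3) k) : Prop :=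
  ∃ (A : Matrix (Fin 3) (Fin 3) k) (b : Fin 3 → k), IsUnit A.det ∧
    ∀ i : Fin 3, α (X i) = (∑ j : Fin 3, C (A j i) * X j) + C (b i)

/-- `Aff_3(k)` as a set of automorphisms. -/
def AffSet : Set (MvPolynomial (Fin 3) k ≃ₐ[k] MvPolynomial (Fin 3) k) := {α | IsAffine α}

/-- `α` is a triangular automorphism: `α(x_i) = a_i x_i + f_i(x_1,…,x_{i-1})`, `a_i ≠ 0`. -/
def IsTriangular (α : MvPolynomial (Fin 3) k ≃ₐ[k] MvPolynomial (Fin 3) k) : Prop :=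
  ∃ (a : Fin 3 → k) (p : Fin 3 → MvPolynomial (Fin 3) k),
    (∀ i, a i ≠ 0) ∧ (∀ i, p i ∈ MvPolynomial.supported k {j | j < i}) ∧
    (∀ i, α (X i) = C (a i) * X i + p i)

/-- `BA_3(k)` as a set of automorphisms. -/
def TriSet : Set (MvPolynomial (Fin 3) k ≃ₐ[k] MvPolynomial (Fin 3) k) := {α | IsTriangular α}

/-- The tame subgroup `TA_3(k) = ⟨Aff_3(k), BA_3(k)⟩`. -/
def TA : Subgroup (MvPolynomial (Fin 3) k ≃ₐ[k] MvPolynomial (Fin 3) k) :=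
  Subgroup.closure (AffSet ∪ TriSet)

/-- `β = β_u = (u^3 x1, u^2 x2, u x3)`. -/
def IsBeta (u : k) (β : MvPolynomial (Fin 3) k ≃ₐ[k] MvPolynomial (Fin 3) k) : Prop :=
  β (X 0) = C (u ^ 3) * X 0 ∧ β (X 1) = C (u ^ 2) * X 1 ∧ β (X 2) = C u * X 2

/-- `B = {β_u | u ∈ k^*}`. -/
def BSet : Set (MvPolynomial (Fin 3) k ≃ₐ[k] MvPolynomial (Fin 3) k) :=
  {β | ∃ u : k, u ≠ 0 ∧ IsBeta u β}

/-! Six-variable ring `k[x1,x2,x3,t_r,t_f,t_g]`: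
variables `X 0 = x1, X 1 = x2, X 2 = x3, X 3 = t_r, X 4 = t_f, X 5 = t_g`. -/

/-- The inclusion of variable index sets. -/
def ι36 : Fin 3 → Fin 6 := Fin.castLE (by norm_num)

/-- The embedding `k[x1,x2,x3] → k[x1,x2,x3,t_r,t_f,t_g]`. -/
def embP : MvPolynomial (Fin 3) k →ₐ[k] MvPolynomial (Fin 6) k := rename ι36

/-- The substitution map `π : t_r ↦ r, t_f ↦ f, t_g ↦ g` (fixing `x1,x2,x3`). -/
def piMap : MvPolynomial (Fin 6) k →ₐ[k] MvPolynomial (Fin 3) k :=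
  aeval ![X 0, X 1, X 2, rP, fP, gP]

/-- The triangular derivation
`Δ' = -2 t_r t_f ∂/∂x1 + (4 x1 t_r - t_g) ∂/∂x2 + (6 x2 t_r + 2 t_f²) ∂/∂x3 - t_f t_g ∂/∂t_r`. -/
def Del' (p : MvPolynomial (Fin 6) k) : MvPolynomial (Fin 6) k :=
  (-(2 * X 3 * X 4)) * pderiv 0 p + (4 * X 0 * X 3 - X 5) * pderiv 1 p +
  (6 * X 1 * X 3 + 2 * X 4 ^ 2) * pderiv 2 p + (-(X 4 * X 5)) * pderiv 3 p

/-- The weight `w1 = (1,2,3,1,0,1)`. -/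
def w1 : Fin 6 → ℕ := ![1, 2, 3, 1, 0, 1]

/-- The weight `w2 = (0,0,0,0,1,0)`. -/
def w2 : Fin 6 → ℕ := ![0, 0, 0, 0, 1, 0]

/-- The sixth cyclic lexicographic order on exponent vectors: first compare the
exponent of `t_g`, then lexicographically the exponents of `x1,x2,x3,t_r,t_f`. -/
def cyclicLt (a b : Fin 6 →₀ ℕ) : Prop :=
  a 5 < b 5 ∨ (a 5 = b 5 ∧ ∃ m : Fin 5,
    (∀ l : Fin 5, l < m → a l.castSucc = b l.castSucc) ∧ a m.castSucc < b m.castSucc)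

/-- The leading monomial of `p` (for the sixth cyclic lexicographic order) is `m`. -/
def LeadMonIs (p : MvPolynomial (Fin 6) k) (m : Fin 6 →₀ ℕ) : Prop :=
  m ∈ p.support ∧ ∀ m' ∈ p.support, m' ≠ m → cyclicLt m' m

/-- The exponent vector of the monomial `t_f^δ t_g^γ`. -/
def tfMon (γ δ : ℕ) : Fin 6 →₀ ℕ := Finsupp.single 4 δ + Finsupp.single 5 γ

/-- The set `P_{γ,δ}`. -/
def Pset (γ δ : ℕ) : Set (MvPolynomial (Fin 6) k) :=
  {p | p ≠ 0 ∧ weightedTotalDegree w1 p ≤ γ ∧ weightedTotalDegree w2 p ≤ δ ∧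
    LeadMonIs p (tfMon γ δ)}

/-- `α'` is a lift of `α`. -/
def IsLift (α : MvPolynomial (Fin 3) k ≃ₐ[k] MvPolynomial (Fin 3) k)
    (α' : MvPolynomial (Fin 6) k →ₐ[k] MvPolynomial (Fin 6) k) : Prop :=
  (∀ i : Fin 3, α' (X (ι36 i)) = embP (α (X i))) ∧
  (∀ p, piMap (α' p) = α (piMap p))

/-- `t = γ_j = max {i | a_{i,j} ≠ 0}` (with rows indexed `1,2,3`). -/
def TypeIs (A : Matrix (Fin 3) (Fin 3) k) (j : Fin 3) (t : ℕ) : Prop :=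
  ∃ i : Fin 3, t = (i : ℕ) + 1 ∧ A i j ≠ 0 ∧ ∀ i' : Fin 3, i < i' → A i' j = 0

/-- Condition (C) for a lift `α'` of an affine automorphism of type `(γ1,γ2,γ3)`,
relative to `φ' = exp(uΔ')`. -/
def CondC (γ1 γ2 γ3 : ℕ) (φ' : MvPolynomial (Fin 6) k ≃ₐ[k] MvPolynomial (Fin 6) k)
    (α' : MvPolynomial (Fin 6) k →ₐ[k] MvPolynomial (Fin 6) k) : Prop :=
  ∃ m4 m5 m6 n4 n5 n6 : ℕ,
    1 ≤ n4 ∧ 1 ≤ n5 ∧ 1 ≤ n6 ∧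
    φ' (α' (X 3)) ∈ Pset m4 n4 ∧
    φ' (α' (X 4)) ∈ Pset m5 n5 ∧
    φ' (α' (X 5)) ∈ Pset m6 n6 ∧
    γ1 ≤ m6 ∧ γ2 ≤ 2 * m6 ∧ γ3 ≤ 3 * m6 ∧ m4 ≤ m6 ∧
    γ1 + 1 ≤ n6 - 1 ∧ γ2 + 1 ≤ 2 * (n6 - 1) ∧ γ3 + 1 ≤ 3 * (n6 - 1) ∧ n4 ≤ n6 - 1

/-- The image of `x_j` under the affine map given by `(A, d)`, inside the six-variable ring. -/
def affImg (A : Matrix (Fin 3) (Fin 3) k) (d : Fin 3 → k) (j : Fin 3) :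
    MvPolynomial (Fin 6) k :=
  (∑ i : Fin 3, C (A i j) * X (ι36 i)) + C (d j)

/-- The image of `t_f` under the lift `α̂`:
`α̂(t_f) = α(f) + (a_{1,1}a_{3,3} - 2a_{1,2}a_{3,2} + a_{1,3}a_{3,1})(t_f - f)`. -/
def hatTf (A : Matrix (Fin 3) (Fin 3) k) (d : Fin 3 → k) : MvPolynomial (Fin 6) k :=
  (affImg A d 0 * affImg A d 2 - affImg A d 1 ^ 2) +
    C (A 0 0 * A 2 2 - 2 * (A 0 1 * A 2 1) + A 0 2 * A 2 0) *
      (X 4 - (X 0 * X 2 - X 1 ^ 2))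

/-- The lift `α̂` of the affine automorphism given by `(A, d)`:
`α̂(x_i) = α(x_i)`, `α̂(t_f)` as in `hatTf`, `α̂(t_r) = α̂(x2 t_f + x1²)`,
`α̂(t_g) = α̂(x3 t_f² + 2 x1 x2 t_f + x1³)`. -/
def hatLift (A : Matrix (Fin 3) (Fin 3) k) (d : Fin 3 → k) :
    MvPolynomial (Fin 6) k →ₐ[k] MvPolynomial (Fin 6) k :=
  aeval ![affImg A d 0, affImg A d 1, affImg A d 2,
    affImg A d 1 * hatTf A d + affImg A d 0 ^ 2,
    hatTf A d,
    affImg A d 2 * hatTf A d ^ 2 + 2 * affImg A d 0 * affImg A d 1 * hatTf A d +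
      affImg A d 0 ^ 3]

/-! ### Polynomials with bounded weighted degrees -/

/-- The polynomials all of whose monomials have `w1`-weight at most `γ` and `w2`-weight at
most `δ`. -/
def degBox (γ δ : ℕ) : Submodule k (MvPolynomial (Fin 6) k) where
  carrier := {p | ∀ m, coeff m p ≠ 0 →
    m 0 + 2 * m 1 + 3 * m 2 + m 3 + m 5 ≤ γ ∧ m 4 ≤ δ}
  zero_mem' := by intro m hm; simp at hm
  add_mem' := by
    intro p q hp hq m hm
    by_cases h : coeff m p = 0
    · exact hq m (by simpa [h] using hm)
    · exact hp m h
  smul_mem' := by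
    intro c p hp m hm
    exact hp m (by intro h; simp [h] at hm)

theorem degBox_mono {γ δ γ' δ' : ℕ} (hγ : γ' ≤ γ) (hδ : δ' ≤ δ)
    {p : MvPolynomial (Fin 6) k} (hp : p ∈ degBox γ' δ') : p ∈ degBox γ δ :=
  fun m hm => ⟨(hp m hm).1.trans hγ, (hp m hm).2.trans hδ⟩

theorem mul_mem_degBox {γ δ γ' δ' : ℕ} {p q : MvPolynomial (Fin 6) k}
    (hp : p ∈ degBox γ δ) (hq : q ∈ degBox γ' δ') : p * q ∈ degBox (γ + γ') (δ + δ') := by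
  intro m hm
  rw [coeff_mul] at hm
  obtain ⟨⟨a, b⟩, hab, hne⟩ := Finset.exists_ne_zero_of_sum_ne_zero hm
  have hab' : a + b = m := by simpa using hab
  have h1 := hp a (left_ne_zero_of_mul hne)
  have h2 := hq b (right_ne_zero_of_mul hne)
  subst hab'
  simp only [Finsupp.add_apply]
  omega

/-- The monomial `a * x1^{e0} x2^{e1} x3^{e2} t_r^{e3} t_f^{e4} t_g^{e5}`. -/
def mon (a : k) (e0 e1 e2 e3 e4 e5 : ℕ) : MvPolynomial (Fin 6) k :=
  C a * X 0 ^ e0 * X 1 ^ e1 * X 2 ^ e2 * X 3 ^ e3 * X 4 ^ e4 * X 5 ^ e5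

theorem mon_eq_monomial (a : k) (e0 e1 e2 e3 e4 e5 : ℕ) :
    mon a e0 e1 e2 e3 e4 e5 = monomial (Finsupp.single 0 e0 + Finsupp.single 1 e1 +
      Finsupp.single 2 e2 + Finsupp.single 3 e3 + Finsupp.single 4 e4 + Finsupp.single 5 e5) a := by
  simp [mon, X_pow_eq_monomial, C_mul_monomial, monomial_mul]

theorem mon_mem_degBox {γ δ : ℕ} (a : k) {e0 e1 e2 e3 e4 e5 : ℕ}
    (hγ : e0 + 2 * e1 + 3 * e2 + e3 + e5 ≤ γ) (hδ : e4 ≤ δ) :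
    mon a e0 e1 e2 e3 e4 e5 ∈ degBox γ δ := by
  intro m hm
  rw [mon_eq_monomial, coeff_monomial] at hm
  split_ifs at hm with h
  · subst h
    simp
    omega
  · simp at hm

theorem C_mem_degBox (a : k) : (C a : MvPolynomial (Fin 6) k) ∈ degBox 0 0 := by
  simpa [mon] using mon_mem_degBox (γ := 0) (δ := 0) a (e0 := 0) (e1 := 0) (e2 := 0) (e3 := 0)
    (e4 := 0) (e5 := 0) (by simp) (by simp)

theorem C_mul_mem_degBox {γ δ : ℕ} (a : k) {p : MvPolynomial (Fin 6) k} (hp : p ∈ degBox γ δ) :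
    C a * p ∈ degBox γ δ := by
  rw [C_mul']
  exact Submodule.smul_mem _ _ hp

/-- `p` has weighted degrees bounded by `(γ, δ)`, and `c` is its coefficient at `t_f^δ t_g^γ`. -/
def HasTop (γ δ : ℕ) (c : k) (p : MvPolynomial (Fin 6) k) : Prop :=
  p ∈ degBox γ δ ∧ coeff (tfMon γ δ) p = c

theorem tfMon_apply (γ δ : ℕ) (i : Fin 6) :
    tfMon γ δ i = if i = 4 then δ else if i = 5 then γ else 0 := by
  fin_cases i <;> simp [tfMon]

theorem eq_tfMon {γ δ : ℕ} {m : Fin 6 →₀ ℕ}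
    (h1 : m 0 + 2 * m 1 + 3 * m 2 + m 3 + m 5 ≤ γ) (h5 : γ ≤ m 5) (h4 : m 4 = δ) :
    m = tfMon γ δ := by
  ext i
  rw [tfMon_apply]
  fin_cases i <;> simp <;> omega

theorem HasTop.mem_Pset {γ δ : ℕ} {c : k} {p : MvPolynomial (Fin 6) k}
    (h : HasTop γ δ c p) (hc : c ≠ 0) : p ∈ Pset γ δ := by
  obtain ⟨hp, rfl⟩ := h
  refine ⟨?_, ?_, ?_, mem_support_iff.2 hc, ?_⟩
  · rintro rfl
    simp at hc
  · refine Finset.sup_le fun m hm => ?_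
    have := (hp m (mem_support_iff.1 hm)).1
    simp [Finsupp.weight_apply, Finsupp.sum_fintype, Fin.sum_univ_six, w1]
    omega
  · refine Finset.sup_le fun m hm => ?_
    have := (hp m (mem_support_iff.1 hm)).2
    simp [Finsupp.weight_apply, Finsupp.sum_fintype, Fin.sum_univ_six, w2]
    omega
  · intro m hm hne
    have hm' := hp m (mem_support_iff.1 hm)
    have h4 : ¬ (γ ≤ m 5 ∧ m 4 = δ) := fun h => hne (eq_tfMon hm'.1 h.1 h.2)
    by_cases h5 : m 5 < γ
    · left
      simpa [tfMon_apply] using h5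
    · right
      refine ⟨by rw [tfMon_apply]; simp; omega, 4, ?_, ?_⟩
      · intro l hl
        rw [tfMon_apply]
        fin_cases l <;> simp at hl ⊢ <;> omega
      · rw [tfMon_apply]
        simp only [Fin.reduceCastSucc, if_true]
        omega

theorem HasTop.add_lower {γ δ γ' δ' : ℕ} {c : k} {p q : MvPolynomial (Fin 6) k}
    (hp : HasTop γ δ c p) (hq : q ∈ degBox γ' δ') (hγ : γ' ≤ γ) (hδ : δ' ≤ δ)
    (hlt : γ' < γ ∨ δ' < δ) : HasTop γ δ c (p + q) := by
  refine ⟨Submodule.add_mem _ hp.1 (degBox_mono hγ hδ hq), ?_⟩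
  have : coeff (tfMon γ δ) q = 0 := by
    by_contra h
    have := hq _ h
    simp [tfMon_apply] at this
    omega
  rw [coeff_add, this, add_zero, hp.2]

theorem HasTop.mul {γ δ γ' δ' : ℕ} {c c' : k} {p q : MvPolynomial (Fin 6) k}
    (hp : HasTop γ δ c p) (hq : HasTop γ' δ' c' q) :
    HasTop (γ + γ') (δ + δ') (c * c') (p * q) := by
  refine ⟨mul_mem_degBox hp.1 hq.1, ?_⟩
  have hadd : tfMon γ δ + tfMon γ' δ' = tfMon (γ + γ') (δ + δ') := by
    ext i
    simp only [Finsupp.add_apply, tfMon_apply]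
    split_ifs <;> rfl
  rw [coeff_mul, Finset.sum_eq_single (tfMon γ δ, tfMon γ' δ')]
  · rw [hp.2, hq.2]
  · rintro ⟨a, b⟩ hab hne
    by_contra hmul
    have hab' : a + b = tfMon (γ + γ') (δ + δ') := by simpa using hab
    have ha := hp.1 a (left_ne_zero_of_mul hmul)
    have hb := hq.1 b (right_ne_zero_of_mul hmul)
    have h4 := DFunLike.congr_fun hab' 4
    have h5 := DFunLike.congr_fun hab' 5
    simp [tfMon_apply] at h4 h5
    apply hne
    rw [Prod.mk.injEq]
    exact ⟨eq_tfMon ha.1 (by omega) (by omega), eq_tfMon hb.1 (by omega) (by omega)⟩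
  · intro h
    exact absurd (by simpa using hadd) h

theorem HasTop.C_mul {γ δ : ℕ} {c : k} {p : MvPolynomial (Fin 6) k} (a : k)
    (hp : HasTop γ δ c p) : HasTop γ δ (a * c) (C a * p) :=
  ⟨C_mul_mem_degBox a hp.1, by rw [coeff_C_mul, hp.2]⟩

theorem HasTop.sq {γ δ : ℕ} {c : k} {p : MvPolynomial (Fin 6) k} (hp : HasTop γ δ c p) :
    HasTop (2 * γ) (2 * δ) (c ^ 2) (p ^ 2) := by
  rw [pow_two, pow_two, two_mul, two_mul]
  exact hp.mul hp

theorem HasTop.cube {γ δ : ℕ} {c : k} {p : MvPolynomial (Fin 6) k} (hp : HasTop γ δ c p) :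
    HasTop (3 * γ) (3 * δ) (c ^ 3) (p ^ 3) := by
  have h := hp.sq.mul hp
  rwa [← pow_succ, ← pow_succ, ← Nat.succ_mul, ← Nat.succ_mul] at h

theorem hasTop_mon (a : k) (γ δ : ℕ) : HasTop γ δ a (mon a 0 0 0 0 δ γ) := by
  refine ⟨mon_mem_degBox a (by simp) le_rfl, ?_⟩
  simp [mon_eq_monomial, tfMon]

/-! ### The exponential of `u • Δ'` on the variables -/

theorem C_ofNat {σ : Type*} (n : ℕ) [n.AtLeastTwo] :
    (C (ofNat(n) : k) : MvPolynomial σ k) = ofNat(n) :=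
  map_ofNat C n

theorem pderiv_ofNat {σ : Type*} (i : σ) (n : ℕ) [n.AtLeastTwo] :
    pderiv i (ofNat(n) : MvPolynomial σ k) = 0 := by
  rw [← C_ofNat]
  exact pderiv_C

theorem Del'_smul (c : k) (p : MvPolynomial (Fin 6) k) : Del' (c • p) = c • Del' p := by
  simp [Del', smul_add]

/-- If `e n = Δ'^n (e 0) / n!`, then `exp (u Δ') (e 0) = ∑ u^n e n`. -/
theorem exp_eq_sum [CharZero k] {u : k}
    {φ' : MvPolynomial (Fin 6) k ≃ₐ[k] MvPolynomial (Fin 6) k}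
    (hφ' : IsExpOf (fun p => u • Del' p) φ') (e : ℕ → MvPolynomial (Fin 6) k) (N : ℕ)
    (he : ∀ n < N, Del' (e n) = ((n : k) + 1) • e (n + 1)) (hN : e N = 0) :
    φ' (e 0) = ∑ i ∈ Finset.range N, C (u ^ i) * e i := by
  have key : ∀ n ≤ N, (fun p => u • Del' p)^[n] (e 0) = ((n.factorial : k) * u ^ n) • e n := by
    intro n
    induction n with
    | zero => intro _; simp
    | succ n ih =>
      intro hn
      rw [Function.iterate_succ_apply', ih (by omega)]
      simp only [Del'_smul, he n (by omega), smul_smul]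
      congr 1
      rw [Nat.factorial_succ]
      push_cast
      ring
  rw [hφ' (e 0) N (by rw [key N le_rfl, hN, smul_zero])]
  refine Finset.sum_congr rfl fun i hi => ?_
  rw [key i (Finset.mem_range.1 hi).le, smul_smul, ← mul_assoc,
    inv_mul_cancel₀ (Nat.cast_ne_zero.2 i.factorial_ne_zero), one_mul, C_mul']

section Exponential

variable [CharZero k] {u : k} {φ' : MvPolynomial (Fin 6) k ≃ₐ[k] MvPolynomial (Fin 6) k}

theorem exp_tf (hφ' : IsExpOf (fun p => u • Del' p) φ') : φ' (X 4) = X 4 := by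
  have h := exp_eq_sum hφ' (fun n => match n with | 0 => X 4 | _ => 0) 1
    (by intro n hn; interval_cases n; simp [Del', pderiv_X]) rfl
  simpa using h

theorem exp_tg (hφ' : IsExpOf (fun p => u • Del' p) φ') : φ' (X 5) = X 5 := by
  have h := exp_eq_sum hφ' (fun n => match n with | 0 => X 5 | _ => 0) 1
    (by intro n hn; interval_cases n; simp [Del', pderiv_X]) rfl
  simpa using h

theorem hasTop_exp_tr (hφ' : IsExpOf (fun p => u • Del' p) φ') :
    HasTop 1 1 (-u) (φ' (X 3)) := by
  have h := exp_eq_sum hφ' (fun n => match n with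
      | 0 => X 3
      | 1 => -(X 4 * X 5)
      | _ => 0) 2
    (by intro n hn; interval_cases n <;> simp [Del', pderiv_X]) rfl
  have h' : φ' (X 3) = mon (-u) 0 0 0 0 1 1 + mon 1 0 0 0 1 0 0 := by
    simp [Finset.sum_range_succ] at h
    rw [h]
    simp [mon]
    ring
  rw [h']
  exact (hasTop_mon _ _ _).add_lower (mon_mem_degBox (γ := 1) (δ := 0) _ (by simp) (by simp))
    (by simp) (by simp) (by simp)

theorem hasTop_exp_x1 (hφ' : IsExpOf (fun p => u • Del' p) φ') :
    HasTop 1 2 (u ^ 2) (φ' (X 0)) := by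
  have h := exp_eq_sum hφ' (fun n => match n with
      | 0 => X 0
      | 1 => -(2 * X 3 * X 4)
      | 2 => X 4 ^ 2 * X 5
      | _ => 0) 3
    (by
      intro n hn
      interval_cases n <;> simp [Del', pderiv_X, smul_eq_C_mul, pderiv_ofNat]
      ring) rfl
  have h' : φ' (X 0) = mon (u ^ 2) 0 0 0 0 2 1 + (mon 1 1 0 0 0 0 0 +
      mon (-2 * u) 0 0 0 1 1 0) := by
    simp [Finset.sum_range_succ] at h
    rw [h]
    simp [mon, C_ofNat]
    ring
  rw [h']
  refine (hasTop_mon _ _ _).add_lower (γ' := 1) (δ' := 1) ?_ (by simp) (by simp) (by simp)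
  exact Submodule.add_mem _ (mon_mem_degBox _ (by simp) (by simp))
    (mon_mem_degBox _ (by simp) (by simp))

theorem hasTop_exp_x2 (hφ' : IsExpOf (fun p => u • Del' p) φ') :
    HasTop 2 3 (-u ^ 4) (φ' (X 1)) := by
  have h := exp_eq_sum hφ' (fun n => match n with
      | 0 => X 1
      | 1 => 4 * X 0 * X 3 - X 5
      | 2 => -(4 * X 3 ^ 2 * X 4) - 2 * X 0 * X 4 * X 5
      | 3 => 4 * X 3 * X 4 ^ 2 * X 5
      | 4 => -(X 4 ^ 3 * X 5 ^ 2)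
      | _ => 0) 5
    (by
      intro n hn
      interval_cases n <;> simp [Del', pderiv_X, smul_eq_C_mul, pderiv_ofNat, C_ofNat] <;> ring) rfl
  have h' : φ' (X 1) = mon (-u ^ 4) 0 0 0 0 3 2 + (mon 1 0 1 0 0 0 0 +
      mon (4 * u) 1 0 0 1 0 0 + mon (-u) 0 0 0 0 0 1 + mon (-4 * u ^ 2) 0 0 0 2 1 0 +
      mon (-2 * u ^ 2) 1 0 0 0 1 1 + mon (4 * u ^ 3) 0 0 0 1 2 1) := by
    simp [Finset.sum_range_succ] at h
    rw [h]
    simp [mon, C_ofNat]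
    ring
  rw [h']
  refine (hasTop_mon _ _ _).add_lower (γ' := 2) (δ' := 2) ?_ (by simp) (by simp) (by simp)
  repeat' apply Submodule.add_mem
  all_goals exact mon_mem_degBox _ (by simp) (by simp)

theorem hasTop_exp_x3 (hφ' : IsExpOf (fun p => u • Del' p) φ') :
    HasTop 3 4 (u ^ 6) (φ' (X 2)) := by
  have h := exp_eq_sum hφ' (fun n => match n with
      | 0 => X 2
      | 1 => 6 * X 1 * X 3 + 2 * X 4 ^ 2
      | 2 => 12 * X 0 * X 3 ^ 2 - 3 * X 3 * X 5 - 3 * X 1 * X 4 * X 5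
      | 3 => -(8 * X 3 ^ 3 * X 4) - 12 * X 0 * X 3 * X 4 * X 5 + 2 * X 4 * X 5 ^ 2
      | 4 => 12 * X 3 ^ 2 * X 4 ^ 2 * X 5 + 3 * X 0 * X 4 ^ 2 * X 5 ^ 2
      | 5 => -(6 * X 3 * X 4 ^ 3 * X 5 ^ 2)
      | 6 => X 4 ^ 4 * X 5 ^ 3
      | _ => 0) 7
    (by
      intro n hn
      interval_cases n <;> simp [Del', pderiv_X, smul_eq_C_mul, pderiv_ofNat, C_ofNat] <;> ring) rfl
  have h' : φ' (X 2) = mon (u ^ 6) 0 0 0 0 4 3 + (mon 1 0 0 1 0 0 0 +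
      mon (6 * u) 0 1 0 1 0 0 + mon (2 * u) 0 0 0 0 2 0 + mon (12 * u ^ 2) 1 0 0 2 0 0 +
      mon (-3 * u ^ 2) 0 0 0 1 0 1 + mon (-3 * u ^ 2) 0 1 0 0 1 1 +
      mon (-8 * u ^ 3) 0 0 0 3 1 0 + mon (-12 * u ^ 3) 1 0 0 1 1 1 +
      mon (2 * u ^ 3) 0 0 0 0 1 2 + mon (12 * u ^ 4) 0 0 0 2 2 1 +
      mon (3 * u ^ 4) 1 0 0 0 2 2 + mon (-6 * u ^ 5) 0 0 0 1 3 2) := by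
    simp [Finset.sum_range_succ] at h
    rw [h]
    simp [mon, C_ofNat]
    ring
  rw [h']
  refine (hasTop_mon _ _ _).add_lower (γ' := 3) (δ' := 3) ?_ (by simp) (by simp) (by simp)
  repeat' apply Submodule.add_mem
  all_goals exact mon_mem_degBox _ (by simp) (by simp)

end Exponential

/-! ### Leading terms of combinations -/

theorem hasTop_X4 : HasTop 0 1 (1 : k) (X 4) := by
  simpa [mon] using hasTop_mon (1 : k) 0 1

theorem hasTop_X5 : HasTop 1 0 (1 : k) (X 5) := by
  simpa [mon] using hasTop_mon (1 : k) 1 0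

/-- Adding a scalar multiple of a polynomial with larger leading term. -/
theorem HasTop.C_mul_add_lower {γ δ γ' δ' : ℕ} {c : k} {p q : MvPolynomial (Fin 6) k} (a : k)
    (hp : HasTop γ δ c p) (hq : q ∈ degBox γ' δ') (hγ : γ' ≤ γ) (hδ : δ' ≤ δ)
    (hlt : γ' < γ ∨ δ' < δ) : HasTop γ δ (a * c) (C a * p + q) :=
  (hp.C_mul a).add_lower hq hγ hδ hlt

theorem exists_hasTop_quadratic {x y z t : MvPolynomial (Fin 6) k} {cx cy cz ct : k}
    (hx : HasTop 1 2 cx x) (hy : HasTop 2 3 cy y) (hz : HasTop 3 4 cz z) (ht : HasTop 0 1 ct t)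
    (hcx : cx ≠ 0) (hcy : cy ≠ 0) (hcz : cz ≠ 0) (c1 c2 c3 c4 c5 c6 c7 c8 : k)
    (hne : ¬ (c1 = 0 ∧ c2 = 0 ∧ c3 = 0 ∧ c4 = 0 ∧ c5 = 0 ∧ c6 = 0)) :
    ∃ m n c, 1 ≤ m ∧ 2 ≤ n ∧ c ≠ 0 ∧ HasTop m n c (C c1 * y ^ 2 + (C c2 * (x * y) +
      (C c3 * z + (C c4 * x ^ 2 + (C c5 * y + (C c6 * x + (C c7 * t + C c8))))))) := by
  have h7 := ht.C_mul_add_lower c7 (C_mem_degBox c8) (by simp) (by simp) (by simp)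
  have h6 := hx.C_mul_add_lower c6 h7.1 (by simp) (by simp) (by simp)
  have h5 := hy.C_mul_add_lower c5 h6.1 (by simp) (by simp) (by simp)
  have h4 := hx.sq.C_mul_add_lower c4 h5.1 (by simp) (by simp) (by simp)
  have h3 := hz.C_mul_add_lower c3 h4.1 (by simp) (by simp) (by simp)
  have h2 := (hx.mul hy).C_mul_add_lower c2 h3.1 (by simp) (by simp) (by simp)
  have h1 := hy.sq.C_mul_add_lower c1 h2.1 (by simp) (by simp) (by simp)
  by_cases e1 : c1 = 0
  · by_cases e2 : c2 = 0
    · by_cases e3 : c3 = 0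
      · by_cases e4 : c4 = 0
        · by_cases e5 : c5 = 0
          · have e6 : c6 ≠ 0 := fun e6 => hne ⟨e1, e2, e3, e4, e5, e6⟩
            subst e1 e2 e3 e4 e5
            exact ⟨1, 2, _, by simp, by simp, mul_ne_zero e6 hcx, by simpa using h6⟩
          · subst e1 e2 e3 e4
            exact ⟨2, 3, _, by simp, by simp, mul_ne_zero e5 hcy, by simpa using h5⟩
        · subst e1 e2 e3
          exact ⟨2 * 1, 2 * 2, _, by simp, by simp, mul_ne_zero e4 (pow_ne_zero 2 hcx),
            by simpa using h4⟩
      · subst e1 e2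
        exact ⟨3, 4, _, by simp, by simp, mul_ne_zero e3 hcz, by simpa using h3⟩
    · subst e1
      exact ⟨1 + 2, 2 + 3, _, by simp, by simp, mul_ne_zero e2 (mul_ne_zero hcx hcy),
        by simpa using h2⟩
  · exact ⟨_, _, _, by simp, by simp, mul_ne_zero e1 (pow_ne_zero 2 hcy), h1⟩

/-! ### Construction of lifts -/

theorem piMap_embP (p : MvPolynomial (Fin 3) k) : piMap (embP p) = p := by
  have h : (piMap.comp embP : MvPolynomial (Fin 3) k →ₐ[k] _) = AlgHom.id k _ := by
    ext i : 1
    fin_cases i <;> simp [piMap, embP, ι36, Fin.castLE]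
  exact DFunLike.congr_fun h p

/-- The endomorphism extending `α` with prescribed values at `t_r`, `t_f`, `t_g`. -/
def liftOf (α : MvPolynomial (Fin 3) k ≃ₐ[k] MvPolynomial (Fin 3) k)
    (R F G : MvPolynomial (Fin 6) k) : MvPolynomial (Fin 6) k →ₐ[k] MvPolynomial (Fin 6) k :=
  aeval ![embP (α (X 0)), embP (α (X 1)), embP (α (X 2)), R, F, G]

theorem isLift_liftOf {α : MvPolynomial (Fin 3) k ≃ₐ[k] MvPolynomial (Fin 3) k}
    {R F G : MvPolynomial (Fin 6) k} (hR : piMap R = α rP) (hF : piMap F = α fP)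
    (hG : piMap G = α gP) : IsLift α (liftOf α R F G) := by
  constructor
  · intro i
    fin_cases i <;> simp [liftOf, ι36, Fin.castLE]
  · intro p
    have h : piMap.comp (liftOf α R F G) = (α : _ →ₐ[k] _).comp piMap := by
      ext i : 1
      fin_cases i <;> simp [liftOf, piMap_embP, hR, hF, hG] <;> simp [piMap]
    exact DFunLike.congr_fun h p

theorem TypeIs.diag {A : Matrix (Fin 3) (Fin 3) k} {j : Fin 3} {t : ℕ} (h : TypeIs A j t)
    (htj : t = (j : ℕ) + 1) : A j j ≠ 0 ∧ ∀ i, j < i → A i j = 0 := by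
  obtain ⟨i, hi, hne, hz⟩ := h
  obtain rfl : i = j := by ext; omega
  exact ⟨hne, hz⟩

theorem exists_lift_of_quadratic_ne [CharZero k] {u : k} (hu : u ≠ 0)
    {φ' : MvPolynomial (Fin 6) k ≃ₐ[k] MvPolynomial (Fin 6) k}
    (hφ' : IsExpOf (fun p => u • Del' p) φ')
    {α : MvPolynomial (Fin 3) k ≃ₐ[k] MvPolynomial (Fin 3) k}
    {a11 a12 a13 a22 a23 a33 d1 d2 d3 : k}
    (hx1 : α (X 0) = C a11 * X 0 + C d1)
    (hx2 : α (X 1) = C a12 * X 0 + C a22 * X 1 + C d2)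
    (hx3 : α (X 2) = C a13 * X 0 + C a23 * X 1 + C a33 * X 2 + C d3)
    (h11 : a11 ≠ 0) (h22 : a22 ≠ 0) (h33 : a33 ≠ 0)
    (hne : ¬ (a11 * a33 - a22 ^ 2 = 0 ∧ a11 * a23 - 2 * a12 * a22 = 0 ∧ d1 * a33 = 0 ∧
      a11 * a13 - a12 ^ 2 = 0 ∧ d1 * a23 - 2 * a22 * d2 = 0 ∧
      d1 * a13 + a11 * d3 - 2 * a12 * d2 = 0)) :
    ∃ α' : MvPolynomial (Fin 6) k →ₐ[k] MvPolynomial (Fin 6) k,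
      IsLift α α' ∧ CondC 1 2 3 φ' α' := by
  have tx := hasTop_exp_x1 hφ'
  have ty := hasTop_exp_x2 hφ'
  have tz := hasTop_exp_x3 hφ'
  have t4 : HasTop 0 1 1 (φ' (X 4)) := by rw [exp_tf hφ']; exact hasTop_X4
  obtain ⟨m, n, c, hm, hn, hc, hF⟩ := exists_hasTop_quadratic tx ty tz t4 (pow_ne_zero 2 hu)
    (neg_ne_zero.2 (pow_ne_zero 4 hu)) (pow_ne_zero 6 hu) _ _ _ _ _ _
    (a11 * a33) (d1 * d3 - d2 ^ 2) hne
  set F : MvPolynomial (Fin 6) k := C (a11 * a33 - a22 ^ 2) * X 1 ^ 2 +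
    (C (a11 * a23 - 2 * a12 * a22) * (X 0 * X 1) + (C (d1 * a33) * X 2 +
    (C (a11 * a13 - a12 ^ 2) * X 0 ^ 2 + (C (d1 * a23 - 2 * a22 * d2) * X 1 +
    (C (d1 * a13 + a11 * d3 - 2 * a12 * d2) * X 0 +
    (C (a11 * a33) * X 4 + C (d1 * d3 - d2 ^ 2))))))) with hFdef
  have hC : ∀ a : k, φ' (C a) = C a := fun a => φ'.commutes a
  have tF : HasTop m n c (φ' F) := by
    simp only [hFdef, map_add φ', map_mul φ', map_pow φ', hC]
    exact hF
  have hπF : piMap F = α fP := by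
    simp only [hFdef, fP, piMap, map_sub, map_add, map_mul, map_pow, hx1, hx2, hx3, aeval_X,
      algHom_C, algebraMap_eq, map_ofNat]
    simp
    ring
  have ex : φ' (embP (α (X 0))) = C a11 * φ' (X 0) + C d1 := by
    simp [hx1, embP, ι36, hC, Fin.castLE]
  have ey : φ' (embP (α (X 1))) = C a22 * φ' (X 1) + (C a12 * φ' (X 0) + C d2) := by
    simp [hx2, embP, ι36, hC, Fin.castLE]
    ring
  have ez : φ' (embP (α (X 2))) =
      C a33 * φ' (X 2) + (C a23 * φ' (X 1) + (C a13 * φ' (X 0) + C d3)) := by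
    simp [hx3, embP, ι36, hC, Fin.castLE]
    ring
  have sx : HasTop 1 2 (a11 * u ^ 2) (φ' (embP (α (X 0)))) := by
    rw [ex]
    exact tx.C_mul_add_lower _ (C_mem_degBox _) (by simp) (by simp) (by simp)
  have sy : HasTop 2 3 (a22 * -u ^ 4) (φ' (embP (α (X 1)))) := by
    rw [ey]
    exact ty.C_mul_add_lower _ (tx.C_mul_add_lower a12 (C_mem_degBox d2)
      (by simp) (by simp) (by simp)).1 (by simp) (by simp) (by simp)
  have sz : HasTop 3 4 (a33 * u ^ 6) (φ' (embP (α (X 2)))) := by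
    rw [ez]
    exact tz.C_mul_add_lower _ (ty.C_mul_add_lower a23 (tx.C_mul_add_lower a13 (C_mem_degBox d3)
      (by simp) (by simp) (by simp)).1 (by simp) (by simp) (by simp)).1
      (by simp) (by simp) (by simp)
  have nx : a11 * u ^ 2 ≠ 0 := mul_ne_zero h11 (pow_ne_zero 2 hu)
  have ny : a22 * -u ^ 4 ≠ 0 := mul_ne_zero h22 (neg_ne_zero.2 (pow_ne_zero 4 hu))
  have nz : a33 * u ^ 6 ≠ 0 := mul_ne_zero h33 (pow_ne_zero 6 hu)
  refine ⟨liftOf α (embP (α (X 1)) * F + embP (α (X 0)) ^ 2) F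
    (embP (α (X 2)) * F ^ 2 + (C 2 * (embP (α (X 0)) * embP (α (X 1)) * F) +
      embP (α (X 0)) ^ 3)),
    isLift_liftOf ?_ hπF ?_, 2 + m, m, 3 + 2 * m, 3 + n, n, 4 + 2 * n,
    by omega, by omega, by omega, ?_, ?_, ?_, by omega, by omega, by omega, by omega, by omega,
    by omega, by omega, by omega⟩
  · simp only [map_add piMap, map_mul piMap, map_pow piMap, piMap_embP, hπF, rP, map_add α,
      map_mul α, map_pow α]
  · have h2 : (C 2 : MvPolynomial (Fin 6) k) = 2 := rfl
    simp only [h2, map_add piMap, map_mul piMap, map_pow piMap, piMap_embP, hπF, gP, map_add α,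
      map_mul α, map_pow α, map_ofNat]
    ring
  · have h : HasTop (2 + m) (3 + n) (a22 * -u ^ 4 * c)
        (φ' (embP (α (X 1)) * F + embP (α (X 0)) ^ 2)) := by
      rw [map_add, map_mul, map_pow]
      exact (sy.mul tF).add_lower sx.sq.1 (by omega) (by omega) (by omega)
    simpa [liftOf] using h.mem_Pset (mul_ne_zero ny hc)
  · simpa [liftOf] using tF.mem_Pset hc
  · have h : HasTop (3 + 2 * m) (4 + 2 * n) (a33 * u ^ 6 * c ^ 2) (φ' (embP (α (X 2)) * F ^ 2 +
        (C 2 * (embP (α (X 0)) * embP (α (X 1)) * F) + embP (α (X 0)) ^ 3))) := by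
      simp only [map_add φ', map_mul φ', map_pow φ', hC]
      exact (sz.mul tF.sq).add_lower (((sx.mul sy).mul tF).C_mul_add_lower 2 sx.cube.1
        (by omega) (by omega) (by omega)).1 (by omega) (by omega) (by omega)
    simpa [liftOf] using h.mem_Pset (mul_ne_zero nz (pow_ne_zero 2 hc))

/-- The case of an automorphism that multiplies `f` by the scalar `a * c`. -/
theorem exists_lift_of_map_f [CharZero k] {u : k} (hu : u ≠ 0)
    {φ' : MvPolynomial (Fin 6) k ≃ₐ[k] MvPolynomial (Fin 6) k}
    (hφ' : IsExpOf (fun p => u • Del' p) φ')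
    {α : MvPolynomial (Fin 3) k ≃ₐ[k] MvPolynomial (Fin 3) k} {a b c s : k}
    (ha : a ≠ 0) (hc : c ≠ 0) (hb : b ^ 2 = a * c)
    (hx1 : α (X 0) = C a * X 0) (hx2 : α (X 1) = C b * (X 1 + C s * X 0))
    (hx3 : α (X 2) = C c * (X 2 + C (2 * s) * X 1 + C (s ^ 2) * X 0))
    (hαB : α ∉ BSet) :
    ∃ α' : MvPolynomial (Fin 6) k →ₐ[k] MvPolynomial (Fin 6) k,
      IsLift α α' ∧ CondC 1 2 3 φ' α' := by
  have tx := hasTop_exp_x1 hφ'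
  have tr := hasTop_exp_tr hφ'
  have hC : ∀ a : k, φ' (C a) = C a := fun a => φ'.commutes a
  have hb0 : b ≠ 0 := by
    rintro rfl
    exact mul_ne_zero ha hc (by rw [← hb]; ring)
  have hbC : (C b : MvPolynomial (Fin 3) k) ^ 2 = C a * C c := by
    rw [← C_pow, hb, C_mul]
  set R : MvPolynomial (Fin 6) k := C (a ^ 2 - a * b * c) * X 0 ^ 2 +
    (C (a * b * c * s) * (X 0 * X 4) + C (a * b * c) * X 3) with hR
  set F : MvPolynomial (Fin 6) k := C (a * c) * X 4 with hF
  set G : MvPolynomial (Fin 6) k := C (a ^ 2 * (a - 2 * b * c + c ^ 3)) * X 0 ^ 3 +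
    (C (2 * s * a ^ 2 * c * (b - c ^ 2)) * (X 0 ^ 2 * X 4) +
    (C (2 * a ^ 2 * c * (b - c ^ 2)) * (X 0 * X 3) +
    (C (s ^ 2 * a ^ 2 * c ^ 3) * (X 0 * X 4 ^ 2) +
    (C (2 * s * a ^ 2 * c ^ 3) * (X 4 * X 3) + C (a ^ 2 * c ^ 3) * X 5)))) with hG
  have hαf : α fP = C (a * c) * fP := by
    simp only [fP, map_sub, map_mul, map_pow, hx1, hx2, hx3, map_ofNat]
    linear_combination (-(X 1 + C s * X 0) ^ 2) * hbC
  have hlift : IsLift α (liftOf α R F G) := by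
    apply isLift_liftOf
    · have h1 : α rP = C b * (X 1 + C s * X 0) * (C (a * c) * fP) + (C a * X 0) ^ 2 := by
        simp only [rP, map_add α, map_mul α, map_pow α, hx1, hx2, hαf]
      rw [h1]
      simp [hR, piMap]
      simp only [rP]
      ring
    · rw [hαf]
      simp [hF, piMap]
    · have h1 : α gP = C c * (X 2 + C (2 * s) * X 1 + C (s ^ 2) * X 0) * (C (a * c) * fP) ^ 2 +
          2 * (C a * X 0) * (C b * (X 1 + C s * X 0)) * (C (a * c) * fP) + (C a * X 0) ^ 3 := by
        simp only [gP, map_add α, map_mul α, map_pow α, hx1, hx2, hx3, hαf, map_ofNat]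
      rw [h1]
      simp [hG, piMap]
      simp only [rP, gP, C_ofNat]
      ring
  have eR : φ' R = C (a ^ 2 - a * b * c) * φ' (X 0) ^ 2 +
      (C (a * b * c * s) * (φ' (X 0) * X 4) + C (a * b * c) * φ' (X 3)) := by
    simp only [hR, map_add φ', map_mul φ', map_pow φ', hC, exp_tf hφ']
  have eG : φ' G = C (a ^ 2 * (a - 2 * b * c + c ^ 3)) * φ' (X 0) ^ 3 +
      (C (2 * s * a ^ 2 * c * (b - c ^ 2)) * (φ' (X 0) ^ 2 * X 4) +
      (C (2 * a ^ 2 * c * (b - c ^ 2)) * (φ' (X 0) * φ' (X 3)) +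
      (C (s ^ 2 * a ^ 2 * c ^ 3) * (φ' (X 0) * X 4 ^ 2) +
      (C (2 * s * a ^ 2 * c ^ 3) * (X 4 * φ' (X 3)) + C (a ^ 2 * c ^ 3) * X 5)))) := by
    simp only [hG, map_add φ', map_mul φ', map_pow φ', hC, exp_tf hφ', exp_tg hφ']
  have tF : φ' F ∈ Pset 0 1 := by
    rw [hF, map_mul, hC, exp_tf hφ']
    exact (hasTop_X4.C_mul (a * c)).mem_Pset (by simp [ha, hc])
  have r1 := tr.C_mul (a * b * c)
  have r2 := (tx.mul hasTop_X4).C_mul_add_lower (a * b * c * s) r1.1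
    (by simp) (by simp) (by simp)
  have r3 := tx.sq.C_mul_add_lower (a ^ 2 - a * b * c) r2.1 (by simp) (by simp) (by simp)
  have g1 := hasTop_X5.C_mul (a ^ 2 * c ^ 3)
  have g2 := (hasTop_X4.mul tr).C_mul_add_lower (2 * s * a ^ 2 * c ^ 3) g1.1
    (by simp) (by simp) (by simp)
  have g3 := (tx.mul hasTop_X4.sq).C_mul_add_lower (s ^ 2 * a ^ 2 * c ^ 3) g2.1
    (by simp) (by simp) (by simp)
  refine ⟨_, hlift, ?_⟩
  have eval3 : liftOf α R F G (X 3) = R := by simp [liftOf]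
  have eval4 : liftOf α R F G (X 4) = F := by simp [liftOf]
  have eval5 : liftOf α R F G (X 5) = G := by simp [liftOf]
  rw [CondC, eval3, eval4, eval5]
  by_cases hlead : a - 2 * b * c + c ^ 3 = 0
  · have hbc : b = c ^ 2 := by
      have : (b - c ^ 2) ^ 2 = 0 := by linear_combination hb + c * hlead
      exact sub_eq_zero.1 (pow_eq_zero_iff two_ne_zero |>.1 this)
    have hac : a = c ^ 3 := by rw [hbc] at hlead; linear_combination hlead
    have hs : s ≠ 0 := by
      rintro rfl
      refine hαB ⟨c, hc, ?_, ?_, ?_⟩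
      · rw [hx1, hac]
      · rw [hx2, hbc]; simp
      · rw [hx3]; simp
    have z1 : a ^ 2 - a * b * c = 0 := by rw [hbc, hac]; ring
    have z2 : b - c ^ 2 = 0 := by rw [hbc]; ring
    refine ⟨1, 0, 1, 3, 1, 4, by omega, by omega, by omega, ?_, tF, ?_, by omega, by omega,
      by omega, by omega, by omega, by omega, by omega, by omega⟩
    · rw [eR, z1, C_0, zero_mul, zero_add]
      exact r2.mem_Pset (by simp [ha, hb0, hc, hs, hu])
    · rw [eG, hlead, z2]
      simp only [mul_zero, C_0, zero_mul, zero_add]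
      exact g3.mem_Pset (by simp [ha, hc, hs, hu])
  · have g4 : HasTop 3 6 (a ^ 2 * (a - 2 * b * c + c ^ 3) * (u ^ 2) ^ 3) (φ' G) := by
      rw [eG]
      refine tx.cube.C_mul_add_lower _ (γ' := 2) (δ' := 5) ?_ (by simp) (by simp) (by simp)
      exact Submodule.add_mem _ (C_mul_mem_degBox _ (tx.sq.mul hasTop_X4).1)
        (Submodule.add_mem _ (C_mul_mem_degBox _
          (degBox_mono (by simp) (by simp) (tx.mul tr).1))
          (degBox_mono (by simp) (by simp) g3.1))
    have hG' := g4.mem_Pset (by simp [ha, hlead, hu])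
    by_cases z1 : a ^ 2 - a * b * c = 0
    · rw [eR, z1, C_0, zero_mul, zero_add]
      by_cases hs : s = 0
      · refine ⟨1, 0, 3, 1, 1, 6, by omega, by omega, by omega, ?_, tF, hG', by omega, by omega,
          by omega, by omega, by omega, by omega, by omega, by omega⟩
        rw [hs, mul_zero, C_0, zero_mul, zero_add]
        exact r1.mem_Pset (by simp [ha, hb0, hc, hu])
      · exact ⟨1, 0, 3, 3, 1, 6, by omega, by omega, by omega,
          r2.mem_Pset (by simp [ha, hb0, hc, hs, hu]), tF, hG', by omega, by omega,
          by omega, by omega, by omega, by omega, by omega, by omega⟩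
    · exact ⟨2, 0, 3, 4, 1, 6, by omega, by omega, by omega,
        eR ▸ r3.mem_Pset (mul_ne_zero z1 (by simp [hu])), tF, hG', by omega, by omega,
        by omega, by omega, by omega, by omega, by omega, by omega⟩

/-- (Lemma 6 of the paper.)  If the type of
`α ∈ Aff_3(k) \ B` is `(1,2,3)`, then there exists a lift of `α`
which satisfies condition (C). -/
theorem statement18 [CharZero k]
    (hln6 : ∀ p : MvPolynomial (Fin 6) k, ∃ l : ℕ, Del'^[l] p = 0)
    (u : k) (hu : u ≠ 0)
    (φ' : MvPolynomial (Fin 6) k ≃ₐ[k] MvPolynomial (Fin 6) k)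
    (hφ' : IsExpOf (fun p => u • Del' p) φ')
    (α : MvPolynomial (Fin 3) k ≃ₐ[k] MvPolynomial (Fin 3) k)
    (A : Matrix (Fin 3) (Fin 3) k) (d : Fin 3 → k)
    (hdet : IsUnit A.det)
    (hαA : ∀ i : Fin 3, α (X i) = (∑ j : Fin 3, C (A j i) * X j) + C (d i))
    (hαB : α ∉ BSet)
    (γ1 γ2 γ3 : ℕ)
    (ht1 : TypeIs A 0 γ1) (ht2 : TypeIs A 1 γ2) (ht3 : TypeIs A 2 γ3)
    (hcase : γ1 = 1 ∧ γ2 = 2 ∧ γ3 = 3) :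
    ∃ α' : MvPolynomial (Fin 6) k →ₐ[k] MvPolynomial (Fin 6) k,
      IsLift α α' ∧ CondC γ1 γ2 γ3 φ' α' := by
  obtain ⟨rfl, rfl, rfl⟩ := hcase
  obtain ⟨h11, hz1⟩ := ht1.diag rfl
  obtain ⟨h22, hz2⟩ := ht2.diag rfl
  obtain ⟨h33, -⟩ := ht3.diag rfl
  have hx1 : α (X 0) = C (A 0 0) * X 0 + C (d 0) := by
    rw [hαA, Fin.sum_univ_three, hz1 1 (by decide), hz1 2 (by decide)]
    simp
  have hx2 : α (X 1) = C (A 0 1) * X 0 + C (A 1 1) * X 1 + C (d 1) := by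
    rw [hαA, Fin.sum_univ_three, hz2 2 (by decide)]
    simp
  have hx3 : α (X 2) = C (A 0 2) * X 0 + C (A 1 2) * X 1 + C (A 2 2) * X 2 + C (d 2) := by
    rw [hαA, Fin.sum_univ_three]
  by_cases hne : A 0 0 * A 2 2 - A 1 1 ^ 2 = 0 ∧ A 0 0 * A 1 2 - 2 * A 0 1 * A 1 1 = 0 ∧
      d 0 * A 2 2 = 0 ∧ A 0 0 * A 0 2 - A 0 1 ^ 2 = 0 ∧ d 0 * A 1 2 - 2 * A 1 1 * d 1 = 0 ∧
      d 0 * A 0 2 + A 0 0 * d 2 - 2 * A 0 1 * d 1 = 0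
  · obtain ⟨e1, e2, e3, e4, e5, e6⟩ := hne
    have hd0 : d 0 = 0 := by simpa [h33] using e3
    have hd1 : d 1 = 0 := by simpa [hd0, h22] using e5
    have hd2 : d 2 = 0 := by simpa [hd0, hd1, h11] using e6
    obtain ⟨s, hs⟩ : ∃ s, A 0 1 = A 1 1 * s := ⟨A 0 1 / A 1 1, by field_simp⟩
    have h12 : A 1 2 = A 2 2 * (2 * s) := by
      apply mul_left_cancel₀ h11
      rw [hs] at e2
      linear_combination e2 - 2 * s * e1
    have h02 : A 0 2 = A 2 2 * s ^ 2 := by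
      apply mul_left_cancel₀ h11
      rw [hs] at e4
      linear_combination e4 - s ^ 2 * e1
    refine exists_lift_of_map_f hu hφ' (a := A 0 0) (b := A 1 1) (c := A 2 2) (s := s) h11 h33
      (by linear_combination -e1) ?_ ?_ ?_ hαB
    · rw [hx1, hd0]
      simp
    · rw [hx2, hd1, hs]
      simp only [C_mul, C_0]
      ring
    · rw [hx3, hd2, h12, h02]
      simp only [C_mul, C_0]
      ring
  · exact exists_lift_of_quadratic_ne hu hφ' hx1 hx2 hx3 h11 h22 h33 hne

end YasudaPaper
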